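/- arXiv:1510.00328 — 4 statements merged into one kernel-verified Lean document; each statement's English description precedes it below -/
import Mathlib

section
/- Fix an integer n ≥ 1, λ ∈ {−1, 1}, t* ∈ ℝ and x* ∈ Eⁿ, and let ψ : ℝ × Eⁿ → ℝ be twice continuously differentiable. Define F : Eⁿ → ℝ by F(x) = ψ(t* + λ‖x − x*‖, x) and, for i = 1,…,n, Gᵢ : Eⁿ → ℝ by Gᵢ(x) = ∂ᵢF(x) − 2λ·((xᵢ − x*ᵢ)/‖x − x*‖)·(∂_tψ)(t* + λ‖x − x*‖, x). Then for every x ≠ x*: (□ψ)(t* + λ‖x − x*‖, x) = Σ_{i=1}^n ∂ᵢGᵢ(x) + (λ(n − 1)/‖x − x*‖)·(∂_tψ)(t* + λ‖x − x*‖, x). -/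
open MeasureTheory Real Filter

noncomputable def pd {n : ℕ} (i : Fin n) (f : EuclideanSpace ℝ (Fin n) → ℝ)
    (x : EuclideanSpace ℝ (Fin n)) : ℝ :=
  fderiv ℝ f x (EuclideanSpace.single i 1)

noncomputable def pdT {n : ℕ} (ψ : ℝ × EuclideanSpace ℝ (Fin n) → ℝ)
    (p : ℝ × EuclideanSpace ℝ (Fin n)) : ℝ :=
  deriv (fun s => ψ (s, p.2)) p.1

noncomputable def pdX {n : ℕ} (i : Fin n) (ψ : ℝ × EuclideanSpace ℝ (Fin n) → ℝ)
    (p : ℝ × EuclideanSpace ℝ (Fin n)) : ℝ :=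
  fderiv ℝ (fun y => ψ (p.1, y)) p.2 (EuclideanSpace.single i 1)

noncomputable def dAlem {n : ℕ} (ψ : ℝ × EuclideanSpace ℝ (Fin n) → ℝ)
    (p : ℝ × EuclideanSpace ℝ (Fin n)) : ℝ :=
  (∑ i, pdX i (pdX i ψ) p) - pdT (pdT ψ) p

section helpers
variable {n : ℕ}

theorem pdT_eq (φ : ℝ × EuclideanSpace ℝ (Fin n) → ℝ) (p : ℝ × EuclideanSpace ℝ (Fin n))
    (h : DifferentiableAt ℝ φ p) :
    pdT φ p = fderiv ℝ φ p (1, 0) := by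
  have h1 : HasDerivAt (fun s : ℝ => (s, p.2)) ((1 : ℝ), (0 : EuclideanSpace ℝ (Fin n))) p.1 :=
    (hasDerivAt_id p.1).prodMk (hasDerivAt_const p.1 p.2)
  exact (HasFDerivAt.comp_hasDerivAt (f := fun s : ℝ => (s, p.2)) p.1 h.hasFDerivAt h1).deriv

theorem pdX_eq (i : Fin n) (φ : ℝ × EuclideanSpace ℝ (Fin n) → ℝ)
    (p : ℝ × EuclideanSpace ℝ (Fin n)) (h : DifferentiableAt ℝ φ p) :
    pdX i φ p = fderiv ℝ φ p (0, EuclideanSpace.single i 1) := by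
  have h1 : HasFDerivAt (fun y : EuclideanSpace ℝ (Fin n) => (p.1, y)) _ p.2 :=
    (hasFDerivAt_const (𝕜 := ℝ) p.1 p.2).prodMk (hasFDerivAt_id (𝕜 := ℝ) p.2)
  have := (HasFDerivAt.comp (f := fun y : EuclideanSpace ℝ (Fin n) => (p.1, y)) p.2
    h.hasFDerivAt h1).fderiv
  unfold pdX
  simp only [Function.comp_def] at this
  rw [this]
  simp

theorem norm_hasFD (xs y : EuclideanSpace ℝ (Fin n)) (hy : y ≠ xs) :
    HasFDerivAt (fun z => ‖z - xs‖) (‖y - xs‖⁻¹ • innerSL ℝ (y - xs)) y := by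
  have h0 : ‖y - xs‖ ≠ 0 := norm_ne_zero_iff.2 (sub_ne_zero.2 hy)
  have h1 := ((hasFDerivAt_id (𝕜 := ℝ) y).sub_const xs).norm_sq
  have h2 := h1.sqrt (by simpa using sub_ne_zero.2 hy)
  simp only [id, Real.sqrt_sq (norm_nonneg _)] at h2
  refine h2.congr_fderiv ?_
  ext v
  simp
  field_simp

theorem w_hasFD (xs y : EuclideanSpace ℝ (Fin n)) (hy : y ≠ xs) (i : Fin n) :
    DifferentiableAt ℝ (fun z : EuclideanSpace ℝ (Fin n) => (z i - xs i) / ‖z - xs‖) y ∧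
    fderiv ℝ (fun z : EuclideanSpace ℝ (Fin n) => (z i - xs i) / ‖z - xs‖) y
      (EuclideanSpace.single i 1) = 1 / ‖y - xs‖ - (y i - xs i) ^ 2 / ‖y - xs‖ ^ 3 := by
  have h0 : ‖y - xs‖ ≠ 0 := norm_ne_zero_iff.2 (sub_ne_zero.2 hy)
  have h1 := (norm_hasFD xs y hy)
  have h2 : HasFDerivAt (fun z : EuclideanSpace ℝ (Fin n) => z i - xs i)
      (EuclideanSpace.proj i : EuclideanSpace ℝ (Fin n) →L[ℝ] ℝ) y :=
    (EuclideanSpace.proj i : EuclideanSpace ℝ (Fin n) →L[ℝ] ℝ).hasFDerivAt.sub_const (xs i)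
  have h3 := h2.fun_mul ((hasDerivAt_inv h0).comp_hasFDerivAt y h1)
  simp only [Function.comp_def, ← div_eq_mul_inv] at h3
  refine ⟨h3.differentiableAt, ?_⟩
  rw [h3.fderiv]
  simp [EuclideanSpace.inner_single_right]
  field_simp
  ring

theorem R_diff (lam ts : ℝ) (xs y : EuclideanSpace ℝ (Fin n)) (hy : y ≠ xs) :
    HasFDerivAt (fun z : EuclideanSpace ℝ (Fin n) => (ts + lam * ‖z - xs‖, z))
      ((lam • (‖y - xs‖⁻¹ • innerSL ℝ (y - xs))).prod (ContinuousLinearMap.id ℝ _)) y :=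
  (((norm_hasFD xs y hy).const_mul lam).const_add ts).prodMk (hasFDerivAt_id y)

theorem chainR (lam ts : ℝ) (xs y : EuclideanSpace ℝ (Fin n)) (hy : y ≠ xs) (i : Fin n)
    (φ : ℝ × EuclideanSpace ℝ (Fin n) → ℝ)
    (h : DifferentiableAt ℝ φ (ts + lam * ‖y - xs‖, y)) :
    DifferentiableAt ℝ (fun z => φ (ts + lam * ‖z - xs‖, z)) y ∧
    fderiv ℝ (fun z => φ (ts + lam * ‖z - xs‖, z)) y (EuclideanSpace.single i 1) =
      pdX i φ (ts + lam * ‖y - xs‖, y) +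
        lam * ((y i - xs i) / ‖y - xs‖) * pdT φ (ts + lam * ‖y - xs‖, y) := by
  have h3 := HasFDerivAt.comp (f := fun z : EuclideanSpace ℝ (Fin n) => (ts + lam * ‖z - xs‖, z))
    y h.hasFDerivAt (R_diff lam ts xs y hy)
  simp only [Function.comp_def] at h3
  refine ⟨h3.differentiableAt, ?_⟩
  rw [h3.fderiv, pdX_eq i φ _ h, pdT_eq φ _ h]
  generalize fderiv ℝ φ (ts + lam * ‖y - xs‖, y) = L
  rw [← smul_eq_mul (lam * _) (L _), ← L.map_smul, ← L.map_add, ContinuousLinearMap.comp_apply]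
  congr 1
  simp [EuclideanSpace.inner_single_right]
  field_simp
  simp

end helpers

/-- divergence form of the d'Alembertian applied to the biased functional form. -/
theorem stmt_2 (n : ℕ) (hn : 1 ≤ n) (lam : ℝ) (hlam : lam = -1 ∨ lam = 1)
    (ts : ℝ) (xs : EuclideanSpace ℝ (Fin n))
    (ψ : ℝ × EuclideanSpace ℝ (Fin n) → ℝ) (hψ : ContDiff ℝ 2 ψ)
    (x : EuclideanSpace ℝ (Fin n)) (hx : x ≠ xs) :
    dAlem ψ (ts + lam * ‖x - xs‖, x) =
      (∑ i : Fin n, pd i (fun y =>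
          pd i (fun z => ψ (ts + lam * ‖z - xs‖, z)) y
          - 2 * lam * ((y i - xs i) / ‖y - xs‖) * pdT ψ (ts + lam * ‖y - xs‖, y)) x)
      + (lam * ((n : ℝ) - 1) / ‖x - xs‖) * pdT ψ (ts + lam * ‖x - xs‖, x) := by
  have hd : Differentiable ℝ ψ := hψ.differentiable (by norm_num)
  have hC : ContDiff ℝ 1 (fderiv ℝ ψ) := hψ.fderiv_right (by norm_num)
  have hD2 : Differentiable ℝ (fderiv ℝ ψ) := hC.differentiable (by norm_num)
  have eT : pdT ψ = fun p => fderiv ℝ ψ p (1, 0) := funext fun p => pdT_eq ψ p (hd p)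
  have eX : ∀ i, pdX i ψ = fun p => fderiv ℝ ψ p (0, EuclideanSpace.single i 1) :=
    fun i => funext fun p => pdX_eq i ψ p (hd p)
  have dT : Differentiable ℝ (pdT ψ) := by
    rw [eT]; exact fun p => (hD2 p).clm_apply (differentiableAt_const _)
  have dX : ∀ i, Differentiable ℝ (pdX i ψ) := by
    intro i; rw [eX i]; exact fun p => (hD2 p).clm_apply (differentiableAt_const _)
  have symm : ∀ i p, pdT (pdX i ψ) p = pdX i (pdT ψ) p := by
    intro i p
    rw [pdT_eq _ p (dX i p), pdX_eq i _ p (dT p), eX, eT,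
      fderiv_clm_apply (hD2 p) (differentiableAt_const _),
      fderiv_clm_apply (hD2 p) (differentiableAt_const _)]
    have := (hψ.contDiffAt (x := p)).isSymmSndFDerivAt (by simp)
    simpa using this (1, 0) (0, EuclideanSpace.single i 1)
  have hl : lam * lam = 1 := by rcases hlam with h | h <;> simp [h]
  have h0 : ‖x - xs‖ ≠ 0 := norm_ne_zero_iff.2 (sub_ne_zero.2 hx)
  set p := (ts + lam * ‖x - xs‖, x) with hp
  have key : ∀ i : Fin n, pd i (fun y =>
          pd i (fun z => ψ (ts + lam * ‖z - xs‖, z)) y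
          - 2 * lam * ((y i - xs i) / ‖y - xs‖) * pdT ψ (ts + lam * ‖y - xs‖, y)) x =
      pdX i (pdX i ψ) p - lam * (1 / ‖x - xs‖ - (x i - xs i) ^ 2 / ‖x - xs‖ ^ 3) * pdT ψ p
        - (x i - xs i) ^ 2 / ‖x - xs‖ ^ 2 * pdT (pdT ψ) p := by
    intro i
    have ev : (fun y =>
          pd i (fun z => ψ (ts + lam * ‖z - xs‖, z)) y
          - 2 * lam * ((y i - xs i) / ‖y - xs‖) * pdT ψ (ts + lam * ‖y - xs‖, y)) =ᶠ[nhds x]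
        (fun y => pdX i ψ (ts + lam * ‖y - xs‖, y) -
          lam * (((y i - xs i) / ‖y - xs‖) * pdT ψ (ts + lam * ‖y - xs‖, y))) := by
      filter_upwards [isOpen_ne.mem_nhds hx] with y hy
      unfold pd
      rw [(chainR lam ts xs y hy i ψ (hd _)).2]
      ring
    unfold pd at ev ⊢
    rw [ev.fderiv_eq]
    obtain ⟨a1, a2⟩ := chainR lam ts xs x hx i (pdX i ψ) (dX i _)
    obtain ⟨b1, b2⟩ := chainR lam ts xs x hx i (pdT ψ) (dT _)
    obtain ⟨c1, c2⟩ := w_hasFD xs x hx i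
    rw [(a1.hasFDerivAt.fun_sub ((c1.hasFDerivAt.fun_mul b1.hasFDerivAt).const_mul lam)).fderiv]
    simp only [_root_.sub_apply, _root_.add_apply,
      _root_.smul_apply, smul_eq_mul, a2, b2, c2, ← hp, symm]
    linear_combination (-(x i - xs i) ^ 2 / ‖x - xs‖ ^ 2 * pdT (pdT ψ) p) * hl
  have hs : ∑ i : Fin n, (x i - xs i) ^ 2 = ‖x - xs‖ ^ 2 := by
    rw [EuclideanSpace.real_norm_sq_eq]; simp
  simp only [key, Finset.sum_sub_distrib, ← Finset.sum_mul, ← Finset.mul_sum,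
    ← Finset.sum_div, hs, dAlem]
  simp
  field_simp
  ring
end

section
/- Let n ≥ 3 be an integer, x* ∈ Eⁿ, and a_n = Γ(n/2)/(2(n−2)π^{n/2}). For every smooth, compactly supported function φ : Eⁿ → ℝ, the function x ↦ a_n‖x − x*‖^{2−n}·Δφ(x) is Lebesgue integrable on Eⁿ and ∫_{Eⁿ} a_n‖x − x*‖^{2−n}·Δφ(x) dx = −φ(x*). (In other words, a_n‖· − x*‖^{2−n} is, in the distributional sense, the Green function of the n-dimensional Poisson equation: its Laplacian equals minus the Dirac delta at x*.) -/
open MeasureTheory Real Filter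

noncomputable def aCoef (n : ℕ) : ℝ :=
  Real.Gamma ((n : ℝ) / 2) / (2 * ((n : ℝ) - 2) * Real.pi ^ ((n : ℝ) / 2))

namespace Green

local notation "EE" n => EuclideanSpace ℝ (Fin n)

lemma pd_contDiff {n : ℕ} (i : Fin n) {f : (EE n) → ℝ} (hf : ContDiff ℝ (⊤ : ℕ∞) f) :
    ContDiff ℝ (⊤ : ℕ∞) (pd i f) := by
  unfold pd
  exact (hf.fderiv_right (m := (⊤ : ℕ∞)) (by norm_cast)).clm_apply contDiff_const

lemma pd_supp {n : ℕ} (i : Fin n) {f : (EE n) → ℝ} (hf : HasCompactSupport f) :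
    HasCompactSupport (pd i f) := hf.fderiv_apply ℝ _

lemma ibp {n : ℕ} (i : Fin n) {u f : (EE n) → ℝ} (hu : ContDiff ℝ (⊤ : ℕ∞) u)
    (hf : ContDiff ℝ (⊤ : ℕ∞) f) (hs : HasCompactSupport f) :
    ∫ x, u x * pd i f x = - ∫ x, pd i u x * f x := by
  refine integral_mul_fderiv_eq_neg_fderiv_mul_of_integrable ?_ ?_ ?_ ?_ ?_
  · exact ((pd_contDiff i hu).continuous.mul hf.continuous).integrable_of_hasCompactSupport
      hs.mul_left
  · exact (hu.continuous.mul (pd_contDiff i hf).continuous).integrable_of_hasCompactSupport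
      (pd_supp i hs).mul_left
  · exact (hu.continuous.mul hf.continuous).integrable_of_hasCompactSupport hs.mul_left
  · exact fun x _ => (hu.differentiable (by simp)) x
  · exact fun x _ => (hf.differentiable (by simp)) x

lemma green {n : ℕ} {u f : (EE n) → ℝ} (hu : ContDiff ℝ (⊤ : ℕ∞) u)
    (hf : ContDiff ℝ (⊤ : ℕ∞) f) (hs : HasCompactSupport f) :
    ∫ x, u x * ∑ i, pd i (fun y => pd i f y) x = ∫ x, (∑ i, pd i (pd i u) x) * f x := by
  simp_rw [Finset.mul_sum, Finset.sum_mul]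
  rw [integral_finsetSum, integral_finsetSum]
  · refine Finset.sum_congr rfl fun i _ => ?_
    have h1 := ibp i hu (pd_contDiff i hf) (pd_supp i hs)
    have h2 := ibp i (pd_contDiff i hu) hf hs
    rw [h2, neg_neg] at h1
    exact h1
  · intro i _
    exact ((pd_contDiff i (pd_contDiff i hu)).continuous.mul hf.continuous).integrable_of_hasCompactSupport
      hs.mul_left
  · intro i _
    exact (hu.continuous.mul (pd_contDiff i (pd_contDiff i hf)).continuous).integrable_of_hasCompactSupport
      (pd_supp i (pd_supp i hs)).mul_left

noncomputable def w {n : ℕ} (e s : ℝ) (x : EE n) : ℝ := (e ^ 2 + ‖x‖ ^ 2) ^ s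

lemma base_pos {n : ℕ} {e : ℝ} (he : 0 < e) (x : EE n) : 0 < e ^ 2 + ‖x‖ ^ 2 := by positivity

lemma w_contDiff {n : ℕ} {e : ℝ} (he : 0 < e) (s : ℝ) :
    ContDiff ℝ (⊤ : ℕ∞) (w (n := n) e s) := by
  unfold w
  exact (contDiff_const.add (contDiff_norm_sq ℝ)).rpow_const_of_ne fun x => (base_pos he x).ne'

lemma pd_w {n : ℕ} {e : ℝ} (he : 0 < e) (s : ℝ) (i : Fin n) (x : EE n) :
    pd i (w e s) x = 2 * s * (x i * w e (s - 1) x) := by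
  have h1 : HasFDerivAt (fun x : EE n => e ^ 2 + ‖x‖ ^ 2) (2 • innerSL ℝ x) x :=
    (hasStrictFDerivAt_norm_sq x).hasFDerivAt.const_add _
  have h2 := h1.rpow_const (p := s) (Or.inl (base_pos he x).ne')
  unfold pd
  have h3 : fderiv ℝ (w e s) x = _ := h2.fderiv
  rw [h3]
  simp [w, EuclideanSpace.inner_single_right]
  ring

lemma pd_pd_w {n : ℕ} {e : ℝ} (he : 0 < e) (s : ℝ) (i : Fin n) (x : EE n) :
    pd i (pd i (w e s)) x =
      2 * s * (w e (s - 1) x + x i ^ 2 * (2 * (s - 1)) * w e (s - 2) x) := by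
  have h0 : pd i (w e s) = fun x : EE n => 2 * s * (x i * w e (s - 1) x) :=
    funext fun x => pd_w he s i x
  have h1 : HasFDerivAt (fun x : EE n => x i) (EuclideanSpace.proj i : (EE n) →L[ℝ] ℝ) x :=
    (EuclideanSpace.proj i : (EE n) →L[ℝ] ℝ).hasFDerivAt
  have h2 : HasFDerivAt (w e (s - 1)) (fderiv ℝ (w e (s - 1)) x) x :=
    (((w_contDiff (n := n) he (s - 1)).differentiable (by simp)) x).hasFDerivAt
  have h3 := (h1.mul h2).const_mul (2 * s)
  have h4 := pd_w he (s - 1) i x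
  rw [h0]
  unfold pd at h4 ⊢
  have h5 : fderiv ℝ (fun x : EE n => 2 * s * (x i * w e (s - 1) x)) x = _ := h3.fderiv
  rw [h5]
  simp [h4]
  rw [show s - 1 - 1 = s - 2 by ring]
  ring

lemma lap_w {n : ℕ} {e : ℝ} (he : 0 < e) (x : EE n) :
    ∑ i, pd i (pd i (w e ((2 - n) / 2))) x =
      (2 - n) * n * (e ^ 2 * w e (-(n + 2) / 2) x) := by
  simp_rw [pd_pd_w he]
  rw [← Finset.mul_sum, Finset.sum_add_distrib, ← Finset.sum_mul, ← Finset.sum_mul,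
    ← EuclideanSpace.real_norm_sq_eq]
  have : w e ((2 - n) / 2 - 1) x = (e ^ 2 + ‖x‖ ^ 2) * w e (-(n + 2) / 2) x := by
    unfold w
    rw [show ((2 - n) / 2 - 1 : ℝ) = 1 + (-(n + 2) / 2) by ring,
      Real.rpow_add (base_pos he x), Real.rpow_one]
  rw [this, show ((2 - n) / 2 - 2 : ℝ) = (-(n + 2) / 2) by ring]
  simp
  ring

lemma rad_int {n : ℕ} (hn : 3 ≤ n) :
    ∫ y in Set.Ioi (0 : ℝ), y ^ (n - 1) • (n * (1 + y ^ 2) ^ (-(n + 2 : ℝ) / 2)) = 1 := by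
  have key := integral_Ioi_of_hasDerivAt_of_nonneg' (a := 0) (l := 1)
    (g := fun y : ℝ => y ^ n * (1 + y ^ 2) ^ (-(n : ℝ) / 2))
    (g' := fun y : ℝ => y ^ (n - 1) • (n * (1 + y ^ 2) ^ (-(n + 2 : ℝ) / 2))) ?_ ?_ ?_
  · rw [key]; simp; omega
  · intro y _
    have hp : (0 : ℝ) < 1 + y ^ 2 := by positivity
    have h1 : HasDerivAt (fun y : ℝ => 1 + y ^ 2) (2 * y) y := by
      simpa using (hasDerivAt_pow 2 y).const_add 1
    have h2 := (hasDerivAt_pow n y).mul (h1.rpow_const (p := -(n : ℝ) / 2) (Or.inl hp.ne'))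
    refine h2.congr_deriv ?_
    rw [show (-(n : ℝ) / 2) = 1 + (-(n + 2 : ℝ) / 2) by ring, Real.rpow_add hp, Real.rpow_one,
      show (1 + (-(n + 2 : ℝ) / 2) - 1) = (-(n + 2 : ℝ) / 2) by ring]
    obtain ⟨m, rfl⟩ : ∃ m, n = m + 1 := ⟨n - 1, by omega⟩
    simp
    ring
  · intro y hy
    have : (0 : ℝ) < y := hy
    simp only [smul_eq_mul]
    positivity
  · have h1 : Tendsto (fun y : ℝ => (1 + (y ^ 2)⁻¹) ^ (-(n : ℝ) / 2)) atTop (nhds 1) := by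
      have h2 : Tendsto (fun y : ℝ => 1 + (y ^ 2)⁻¹) atTop (nhds (1 + 0)) :=
        ((tendsto_pow_atTop (two_ne_zero)).inv_tendsto_atTop).const_add 1
      have := h2.rpow_const (p := -(n : ℝ) / 2) (Or.inl (by norm_num))
      simpa using this
    refine h1.congr' ?_
    filter_upwards [eventually_gt_atTop 0] with y hy
    have : 1 + (y ^ 2)⁻¹ = (1 + y ^ 2) * (y ^ 2)⁻¹ := by field_simp; ring
    rw [this, Real.mul_rpow (by positivity) (by positivity), mul_comm]
    congr 1
    rw [← Real.rpow_natCast y 2, ← Real.rpow_neg hy.le, ← Real.rpow_mul hy.le, ← Real.rpow_natCast]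
    congr 1
    push_cast; ring

lemma vol_int {n : ℕ} (hn : 3 ≤ n) :
    aCoef n * ((n - 2) * n * ∫ y : EE n, w 1 (-(n + 2) / 2) y) = 1 := by
  have : Nonempty (Fin n) := ⟨⟨0, by omega⟩⟩
  have : Nontrivial (EE n) := by
    have : 0 < Module.finrank ℝ (EE n) := by simp; omega
    exact Module.nontrivial_of_finrank_pos this
  have h := integral_fun_norm_addHaar (volume : Measure (EE n))
    (fun r : ℝ => (n * (1 + r ^ 2) ^ (-(n + 2 : ℝ) / 2) : ℝ))
  simp only [finrank_euclideanSpace, Fintype.card_fin] at h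
  rw [rad_int hn, integral_const_mul] at h
  have h2 : ∫ y : EE n, w 1 (-(n + 2) / 2) y = ∫ y : EE n, (1 + ‖y‖ ^ 2) ^ (-(n + 2 : ℝ) / 2) := by
    simp [w]
  rw [h2, mul_assoc, h, Measure.real, EuclideanSpace.volume_ball]
  have hn' : (3 : ℝ) ≤ n := by exact_mod_cast hn
  have hG : 0 < Real.Gamma ((n : ℝ) / 2) := Real.Gamma_pos_of_pos (by linarith)
  have hpi : √π ^ n = π ^ ((n : ℝ) / 2) := by
    rw [Real.sqrt_eq_rpow, ← Real.rpow_natCast, ← Real.rpow_mul Real.pi_pos.le]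
    congr 1; ring
  have hpp : 0 < π ^ ((n : ℝ) / 2) := by positivity
  simp only [Fintype.card_fin, hpi, aCoef]
  rw [Real.Gamma_add_one (by linarith)]
  have hnn : 0 ≤ π ^ ((n : ℝ) / 2) / ((n : ℝ) / 2 * Real.Gamma ((n : ℝ) / 2)) := by positivity
  have h3 : (n : ℝ) - 2 ≠ 0 := by linarith
  have h4 : (n : ℝ) ≠ 0 := by linarith
  simp [ENNReal.toReal_ofReal hnn]
  field_simp

lemma scal {n : ℕ} {e : ℝ} (he : 0 < e) (f : (EE n) → ℝ) :
    ∫ x, e ^ 2 * w e (-(n + 2) / 2) x * f x = ∫ y, w 1 (-(n + 2) / 2) y * f (e • y) := by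
  have h := Measure.integral_comp_smul_of_nonneg (volume : Measure (EE n))
    (fun x => e ^ 2 * w e (-(n + 2) / 2) x * f x) e (hR := he.le)
  have h2 : ∀ y : EE n, e ^ 2 * w e (-(n + 2) / 2) (e • y) * f (e • y) =
      (e ^ n)⁻¹ * (w 1 (-(n + 2) / 2) y * f (e • y)) := by
    intro y
    have : w e (-(n + 2) / 2) (e • y) = (e ^ (n + 2))⁻¹ * w 1 (-(n + 2) / 2) y := by
      unfold w
      rw [norm_smul, show e ^ 2 + (‖e‖ * ‖y‖) ^ 2 = e ^ 2 * (1 ^ 2 + ‖y‖ ^ 2) by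
        rw [mul_pow, Real.norm_eq_abs, sq_abs]; ring, Real.mul_rpow (by positivity) (by positivity)]
      congr 1
      rw [← Real.rpow_natCast e 2, ← Real.rpow_natCast, ← Real.rpow_neg he.le, ← Real.rpow_mul he.le]
      congr 1; push_cast; ring
    rw [this]
    field_simp
    ring
  simp_rw [h2] at h
  rw [integral_const_mul] at h
  simp only [finrank_euclideanSpace, Fintype.card_fin, smul_eq_mul] at h
  exact (mul_left_cancel₀ (by positivity) h).symm

lemma rhs_lim {n : ℕ} {f : (EE n) → ℝ} (hf : Continuous f) (hs : HasCompactSupport f) :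
    Tendsto (fun e : ℝ => ∫ y, w 1 (-(n + 2) / 2) y * f (e • y)) (nhdsWithin 0 (Set.Ioi 0))
      (nhds ((∫ y : EE n, w 1 (-(n + 2) / 2) y) * f 0)) := by
  obtain ⟨C, hC⟩ := hs.exists_bound_of_continuous hf
  have hwi : Integrable (fun y : EE n => w 1 (-(n + 2) / 2) y) := by
    have := integrable_rpow_neg_one_add_norm_sq (E := (EE n)) (μ := volume) (r := n + 2) (by simp)
    simpa [w] using this
  rw [← integral_mul_const]
  refine tendsto_integral_filter_of_dominated_convergence
    (fun y => w 1 (-(n + 2) / 2) y * C) ?_ ?_ (hwi.mul_const C) ?_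
  · refine Eventually.of_forall fun e => ?_
    exact (hwi.aestronglyMeasurable).mul (hf.comp (by fun_prop)).aestronglyMeasurable
  · refine Eventually.of_forall fun e => Eventually.of_forall fun y => ?_
    have : 0 ≤ w 1 (-(n + 2) / 2) y := by unfold w; positivity
    rw [norm_mul, Real.norm_of_nonneg this]
    exact mul_le_mul_of_nonneg_left (hC _) this
  · refine Eventually.of_forall fun y => ?_
    refine Tendsto.const_mul _ ?_
    have : Continuous fun e : ℝ => f (e • y) := hf.comp (by fun_prop)
    have h := this.tendsto 0
    simp only [zero_smul] at h
    exact h.mono_left nhdsWithin_le_nhds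

lemma lhs_int {n : ℕ} (hn : 3 ≤ n) {g : (EE n) → ℝ} (hg : Continuous g)
    (hs : HasCompactSupport g) :
    Integrable (fun x : EE n => ‖x‖ ^ (2 - (n : ℤ)) * g x) := by
  have : Nontrivial (EE n) := by
    have : 0 < Module.finrank ℝ (EE n) := by simp; omega
    exact Module.nontrivial_of_finrank_pos this
  obtain ⟨C, hC⟩ := hs.exists_bound_of_continuous hg
  obtain ⟨R, hR⟩ := hs.isCompact.isBounded.subset_closedBall 0
  have h1 : Integrable (fun x : EE n =>
      (Set.Iic R).indicator (fun r : ℝ => r ^ (2 - (n : ℤ))) ‖x‖) := by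
    rw [integrable_fun_norm_addHaar (volume : Measure (EE n))
      (f := (Set.Iic R).indicator (fun r : ℝ => r ^ (2 - (n : ℤ))))]
    simp only [finrank_euclideanSpace, Fintype.card_fin]
    have h2 : IntegrableOn ((Set.Iic R).indicator (fun y : ℝ => y)) (Set.Ioi 0) := by
      rw [IntegrableOn, integrable_indicator_iff measurableSet_Iic, IntegrableOn,
        Measure.restrict_restrict measurableSet_Iic, Set.inter_comm, Set.Ioi_inter_Iic]
      exact (continuous_id.integrableOn_Icc).mono_set Set.Ioc_subset_Icc_self
    refine h2.congr_fun (fun y hy => ?_) measurableSet_Ioi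
    have hy0 : y ≠ 0 := (ne_of_gt hy)
    by_cases hyR : y ∈ Set.Iic R
    · simp only [Set.indicator_of_mem hyR, smul_eq_mul]
      rw [← zpow_natCast, ← zpow_add₀ hy0, show ((n - 1 : ℕ) : ℤ) + (2 - n) = 1 by omega, zpow_one]
    · simp [Set.indicator_of_notMem hyR]
  refine (h1.mul_const C).mono' ?_ (Eventually.of_forall fun x => ?_)
  · exact ((by fun_prop : Measurable fun x : EE n => ‖x‖ ^ (2 - (n : ℤ))).aestronglyMeasurable).mul
      hg.aestronglyMeasurable
  · have h0 : 0 ≤ ‖x‖ ^ (2 - (n : ℤ)) := by positivity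
    rw [norm_mul, Real.norm_of_nonneg h0]
    by_cases hx : ‖x‖ ∈ Set.Iic R
    · rw [Set.indicator_of_mem hx]
      exact mul_le_mul_of_nonneg_left (hC _) h0
    · rw [Set.indicator_of_notMem hx]
      have : g x = 0 := by
        by_contra hne
        have := hR (subset_tsupport _ hne)
        simp at this
        exact hx this
      simp [this]

lemma zpow_eq {n : ℕ} {r : ℝ} (hr : 0 < r) :
    r ^ (2 - (n : ℤ)) = (r ^ 2) ^ ((2 - n : ℝ) / 2) := by
  rw [← Real.rpow_natCast r 2, ← Real.rpow_mul hr.le, ← Real.rpow_intCast]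
  congr 1; push_cast; ring

lemma lhs_lim {n : ℕ} (hn : 3 ≤ n) {g : (EE n) → ℝ} (hg : Continuous g)
    (hs : HasCompactSupport g) :
    Tendsto (fun e : ℝ => ∫ y, w e ((2 - n) / 2) y * g y) (nhdsWithin 0 (Set.Ioi 0))
      (nhds (∫ x : EE n, ‖x‖ ^ (2 - (n : ℤ)) * g x)) := by
  have : Nontrivial (EE n) := by
    have : 0 < Module.finrank ℝ (EE n) := by simp; omega
    exact Module.nontrivial_of_finrank_pos this
  have hne : ∀ᵐ x : EE n, x ≠ 0 := by
    simp [ae_iff]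
  have hn' : (3 : ℝ) ≤ n := by exact_mod_cast hn
  refine tendsto_integral_filter_of_dominated_convergence
    (fun x => ‖‖x‖ ^ (2 - (n : ℤ)) * g x‖) ?_ ?_ (lhs_int hn hg hs).norm ?_
  · filter_upwards [self_mem_nhdsWithin] with e he
    exact ((w_contDiff he _).continuous.mul hg).aestronglyMeasurable
  · filter_upwards [self_mem_nhdsWithin] with e he
    filter_upwards [hne] with x hx
    have hx' : 0 < ‖x‖ := norm_pos_iff.2 hx
    rw [norm_mul, norm_mul]
    refine mul_le_mul_of_nonneg_right ?_ (norm_nonneg _)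
    have : 0 ≤ w e ((2 - n) / 2) x := by unfold w; positivity
    rw [Real.norm_of_nonneg this, Real.norm_of_nonneg (by positivity), zpow_eq hx', w]
    exact Real.rpow_le_rpow_of_nonpos (by positivity) (by nlinarith [sq_nonneg e]) (by linarith)
  · filter_upwards [hne] with x hx
    have hx' : 0 < ‖x‖ := norm_pos_iff.2 hx
    refine Tendsto.mul_const _ ?_
    rw [zpow_eq hx']
    unfold w
    have h1 : Tendsto (fun e : ℝ => e ^ 2 + ‖x‖ ^ 2) (nhds 0) (nhds (‖x‖ ^ 2)) := by
      have : Continuous fun e : ℝ => e ^ 2 + ‖x‖ ^ 2 := by fun_prop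
      simpa using this.tendsto 0
    exact (h1.rpow_const (Or.inl (by positivity))).mono_left nhdsWithin_le_nhds

lemma core {n : ℕ} (hn : 3 ≤ n) {f : (EE n) → ℝ}
    (hf : ContDiff ℝ (⊤ : ℕ∞) f) (hs : HasCompactSupport f) :
    Integrable (fun x : EE n =>
      aCoef n * ‖x‖ ^ (2 - (n : ℤ)) * ∑ i : Fin n, pd i (fun y => pd i f y) x) ∧
    ∫ x : EE n,
      aCoef n * ‖x‖ ^ (2 - (n : ℤ)) * ∑ i : Fin n, pd i (fun y => pd i f y) x = -f 0 := by
  have hg : Continuous fun x : EE n => ∑ i : Fin n, pd i (fun y => pd i f y) x :=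
    continuous_finsetSum _ fun i _ => (pd_contDiff i (pd_contDiff i hf)).continuous
  have hgs : HasCompactSupport fun x : EE n => ∑ i : Fin n, pd i (fun y => pd i f y) x := by
    refine HasCompactSupport.intro hs.isCompact fun x hx => ?_
    refine Finset.sum_eq_zero fun i _ => ?_
    refine image_eq_zero_of_notMem_tsupport fun h => hx ?_
    exact tsupport_fderiv_apply_subset ℝ _ (tsupport_fderiv_apply_subset ℝ _ h)
  simp_rw [mul_assoc]
  refine ⟨(lhs_int hn hg hgs).const_mul _, ?_⟩
  rw [integral_const_mul]
  have h1 := lhs_lim hn hg hgs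
  have h2 := (rhs_lim hf.continuous hs).const_mul ((2 - n) * n : ℝ)
  have h3 := tendsto_nhds_unique_of_eventuallyEq h1 h2 (by
    filter_upwards [self_mem_nhdsWithin] with e he
    rw [green (w_contDiff he _) hf hs, ← scal he, ← integral_const_mul]
    refine integral_congr_ae (Eventually.of_forall fun x => ?_)
    simp only [lap_w he]
    ring)
  rw [h3]
  linear_combination (-f 0) * vol_int hn

end Green

/-- `aCoef n * ‖· - x*‖ ^ (2 - n)` is the Green function of the n-dimensional
Poisson equation: its Laplacian is minus the Dirac delta at x*, in the distributional sense. -/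
theorem stmt_6 (n : ℕ) (hn : 3 ≤ n) (xs : EuclideanSpace ℝ (Fin n))
    (φ : EuclideanSpace ℝ (Fin n) → ℝ)
    (hφ : ContDiff ℝ (⊤ : ℕ∞) φ) (hsupp : HasCompactSupport φ) :
    Integrable (fun x : EuclideanSpace ℝ (Fin n) =>
      aCoef n * ‖x - xs‖ ^ (2 - (n : ℤ)) * ∑ i : Fin n, pd i (fun y => pd i φ y) x) ∧
    ∫ x : EuclideanSpace ℝ (Fin n),
      aCoef n * ‖x - xs‖ ^ (2 - (n : ℤ)) * ∑ i : Fin n, pd i (fun y => pd i φ y) x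
      = -φ xs := by
  have hf : ContDiff ℝ (⊤ : ℕ∞) fun y => φ (y + xs) := hφ.comp (contDiff_id.add contDiff_const)
  have hs : HasCompactSupport fun y => φ (y + xs) :=
    hsupp.comp_homeomorph (Homeomorph.addRight xs)
  obtain ⟨h1, h2⟩ := Green.core hn hf hs
  have hpd : ∀ (i : Fin n) (x : EuclideanSpace ℝ (Fin n)),
      pd i (fun y => pd i (fun z => φ (z + xs)) y) x = pd i (fun y => pd i φ y) (x + xs) := by
    intro i x
    have : ∀ g : EuclideanSpace ℝ (Fin n) → ℝ, (fun y => pd i (fun z => g (z + xs)) y)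
        = fun y => pd i g (y + xs) := fun g => by
      funext y
      simp only [pd, fderiv_comp_add_right]
    rw [this]
    exact congrFun (this (pd i φ)) x
  simp_rw [hpd] at h1 h2
  set F := fun x : EuclideanSpace ℝ (Fin n) =>
      aCoef n * ‖x - xs‖ ^ (2 - (n : ℤ)) * ∑ i : Fin n, pd i (fun y => pd i φ y) x with hF
  have hFe : (fun x : EuclideanSpace ℝ (Fin n) => aCoef n * ‖x‖ ^ (2 - (n : ℤ)) *
      ∑ i : Fin n, pd i (fun y => pd i φ y) (x + xs)) = fun x => F (x + xs) := by
    funext x; simp [hF]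
  rw [hFe] at h1 h2
  refine ⟨?_, ?_⟩
  · simpa using h1.comp_sub_right xs
  · rw [integral_add_right_eq_self F xs] at h2
    simpa using h2
end

section
/- Let x* ∈ E². For every smooth, compactly supported function φ : E² → ℝ, the function x ↦ −(1/(2π))·log‖x − x*‖·Δφ(x) is Lebesgue integrable on E² and ∫_{E²} (−(1/(2π))·log‖x − x*‖)·Δφ(x) dx = −φ(x*). (In other words, −(1/(2π))log‖· − x*‖ is, in the distributional sense, the Green function of the two-dimensional Poisson equation: its Laplacian equals minus the Dirac delta at x*.) -/
open MeasureTheory Real Filter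

abbrev E2 := EuclideanSpace ℝ (Fin 2)

lemma pd_contDiff (i : Fin 2) {f : E2 → ℝ} (hf : ContDiff ℝ (⊤ : ℕ∞) f) :
    ContDiff ℝ (⊤ : ℕ∞) (pd i f) := by
  have h : ContDiff ℝ (⊤ : ℕ∞) (fderiv ℝ f) := hf.fderiv_right (by simp)
  exact h.clm_apply contDiff_const

lemma pd_supp (i : Fin 2) {f : E2 → ℝ} (hf : HasCompactSupport f) :
    HasCompactSupport (pd i f) := hf.fderiv_apply ℝ _

lemma ibp (i : Fin 2) {f g : E2 → ℝ} (hf : ContDiff ℝ (⊤ : ℕ∞) f)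
    (hg : ContDiff ℝ (⊤ : ℕ∞) g) (hs : HasCompactSupport g) :
    ∫ x, f x * pd i g x = - ∫ x, pd i f x * g x := by
  have hf' := (pd_contDiff i hf).continuous
  have hg' := (pd_contDiff i hg).continuous
  refine integral_mul_fderiv_eq_neg_fderiv_mul_of_integrable ?_ ?_ ?_ ?_ ?_
  · exact (hf'.mul hg.continuous).integrable_of_hasCompactSupport hs.mul_left
  · exact (hf.continuous.mul hg').integrable_of_hasCompactSupport (pd_supp i hs).mul_left
  · exact (hf.continuous.mul hg.continuous).integrable_of_hasCompactSupport hs.mul_left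
  · exact fun x _ => (hf.differentiable (by simp)).differentiableAt
  · exact fun x _ => (hg.differentiable (by simp)).differentiableAt

/-- regularized logarithm -/
noncomputable def GG (xs : E2) (c : ℝ) (x : E2) : ℝ := 1 / 2 * Real.log (‖x - xs‖ ^ 2 + c ^ 2)

lemma base_contDiff (xs : E2) (c : ℝ) :
    ContDiff ℝ (⊤ : ℕ∞) (fun x : E2 => ‖x - xs‖ ^ 2 + c ^ 2) :=
  ((contDiff_id.sub contDiff_const).norm_sq ℝ).add contDiff_const

lemma base_pos (xs : E2) {c : ℝ} (hc : 0 < c) (x : E2) : 0 < ‖x - xs‖ ^ 2 + c ^ 2 := by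
  positivity

lemma base_fderiv (xs : E2) (c : ℝ) (x : E2) :
    HasFDerivAt (fun x : E2 => ‖x - xs‖ ^ 2 + c ^ 2) (2 • innerSL ℝ (x - xs)) x := by
  have h := (((hasFDerivAt_id (𝕜 := ℝ) x).sub_const xs).norm_sq).add_const (c ^ 2)
  simpa using! h

lemma GG_contDiff (xs : E2) {c : ℝ} (hc : 0 < c) : ContDiff ℝ (⊤ : ℕ∞) (GG xs c) :=
  contDiff_const.mul ((base_contDiff xs c).log fun x => (base_pos xs hc x).ne')

lemma pd_GG (xs : E2) {c : ℝ} (hc : 0 < c) (i : Fin 2) :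
    pd i (GG xs c) = fun x => (x i - xs i) / (‖x - xs‖ ^ 2 + c ^ 2) := by
  ext x
  have h := ((base_fderiv xs c x).log (base_pos xs hc x).ne').const_mul (1 / 2 : ℝ)
  have h' := h.fderiv
  change fderiv ℝ (GG xs c) x = _ at h'
  unfold pd
  rw [h']
  simp [EuclideanSpace.inner_single_right]
  ring

lemma pd_pd_GG (xs : E2) {c : ℝ} (hc : 0 < c) (i : Fin 2) (x : E2) :
    pd i (pd i (GG xs c)) x = 1 / (‖x - xs‖ ^ 2 + c ^ 2)
      - 2 * (x i - xs i) ^ 2 / (‖x - xs‖ ^ 2 + c ^ 2) ^ 2 := by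
  rw [pd_GG xs hc i]
  have hp := base_pos xs hc x
  have h1 : HasFDerivAt (fun x : E2 => x i - xs i) (EuclideanSpace.proj i : E2 →L[ℝ] ℝ) x :=
    (EuclideanSpace.proj i : E2 →L[ℝ] ℝ).hasFDerivAt.sub_const (xs i)
  have h := h1.mul ((hasDerivAt_inv hp.ne').comp_hasFDerivAt x (base_fderiv xs c x))
  unfold pd
  have h2 := h.fderiv
  have h3 : ((fun x : E2 => x i - xs i) * (fun y : ℝ => y⁻¹) ∘ fun x => ‖x - xs‖ ^ 2 + c ^ 2)
      = fun x : E2 => (x i - xs i) / (‖x - xs‖ ^ 2 + c ^ 2) := by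
    ext x; simp [div_eq_mul_inv]
  rw [h3] at h2
  rw [h2]
  simp [EuclideanSpace.inner_single_right]
  field_simp
  ring

lemma lap_GG (xs : E2) {c : ℝ} (hc : 0 < c) (x : E2) :
    ∑ i : Fin 2, pd i (pd i (GG xs c)) x = 2 * c ^ 2 / (‖x - xs‖ ^ 2 + c ^ 2) ^ 2 := by
  have hp := base_pos xs hc x
  simp_rw [pd_pd_GG xs hc]
  have hn : ‖x - xs‖ ^ 2 = (x 0 - xs 0) ^ 2 + (x 1 - xs 1) ^ 2 := by
    rw [EuclideanSpace.norm_sq_eq]; simp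
  rw [Fin.sum_univ_two]
  field_simp
  rw [hn]; ring

lemma step1 (xs : E2) {c : ℝ} (hc : 0 < c) {φ : E2 → ℝ} (hφ : ContDiff ℝ (⊤ : ℕ∞) φ)
    (hs : HasCompactSupport φ) :
    ∫ x, GG xs c x * ∑ i : Fin 2, pd i (pd i φ) x =
      ∫ x, 2 * c ^ 2 / (‖x - xs‖ ^ 2 + c ^ 2) ^ 2 * φ x := by
  have hG := GG_contDiff xs hc
  simp_rw [← lap_GG xs hc, Finset.mul_sum, Finset.sum_mul]
  rw [integral_finsetSum, integral_finsetSum]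
  · refine Finset.sum_congr rfl fun i _ => ?_
    rw [ibp i hG (pd_contDiff i hφ) (pd_supp i hs), ibp i (pd_contDiff i hG) hφ hs, neg_neg]
  · intro i _
    exact ((pd_contDiff i (pd_contDiff i hG)).continuous.mul
      hφ.continuous).integrable_of_hasCompactSupport hs.mul_left
  · intro i _
    exact (hG.continuous.mul (pd_contDiff i (pd_contDiff i hφ)).continuous
      ).integrable_of_hasCompactSupport (pd_supp i (pd_supp i hs)).mul_left

lemma step2 (xs : E2) {c : ℝ} (hc : 0 < c) (φ : E2 → ℝ) :
    ∫ x, 2 * c ^ 2 / (‖x - xs‖ ^ 2 + c ^ 2) ^ 2 * φ x =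
      ∫ y : E2, 2 / (‖y‖ ^ 2 + 1) ^ 2 * φ (xs + c • y) := by
  have h1 := integral_add_left_eq_self (μ := (volume : Measure E2))
    (fun x => 2 * c ^ 2 / (‖x - xs‖ ^ 2 + c ^ 2) ^ 2 * φ x) xs
  have h2 := Measure.integral_comp_smul (volume : Measure E2)
    (fun x => 2 * c ^ 2 / (‖xs + x - xs‖ ^ 2 + c ^ 2) ^ 2 * φ (xs + x)) c
  rw [h1] at h2
  have h3 : |(c ^ Module.finrank ℝ E2)⁻¹| = (c ^ 2)⁻¹ := by
    rw [finrank_euclideanSpace_fin, abs_of_pos (by positivity)]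
  rw [h3, smul_eq_mul, eq_inv_mul_iff_mul_eq₀ (by positivity)] at h2
  rw [← h2, ← integral_const_mul]
  congr 1
  ext y
  rw [add_sub_cancel_left, norm_smul, Real.norm_of_nonneg hc.le]
  have : (c * ‖y‖) ^ 2 + c ^ 2 = c ^ 2 * (‖y‖ ^ 2 + 1) := by ring
  rw [this]
  field_simp

lemma rad : IntegrableOn (fun y : ℝ => y * (2 / (y ^ 2 + 1) ^ 2)) (Set.Ioi 0) ∧
    ∫ y in Set.Ioi (0 : ℝ), y * (2 / (y ^ 2 + 1) ^ 2) = 1 := by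
  have hd : ∀ x ∈ Set.Ici (0 : ℝ), HasDerivAt (fun y : ℝ => - (y ^ 2 + 1)⁻¹)
      (x * (2 / (x ^ 2 + 1) ^ 2)) x := by
    intro x _
    have h := (((hasDerivAt_pow 2 x).add_const 1).fun_inv (by positivity)).fun_neg
    convert! h using 1
    simp
    ring
  have ht : Tendsto (fun y : ℝ => - (y ^ 2 + 1)⁻¹) atTop (nhds (-0)) := by
    refine (tendsto_inv_atTop_zero.comp ?_).neg
    exact tendsto_atTop_add_const_right _ _ (tendsto_pow_atTop (by norm_num))
  have hi := integrableOn_Ioi_deriv_of_nonneg' hd (fun x hx => by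
    have : (0 : ℝ) < x := hx
    positivity) ht
  refine ⟨hi, ?_⟩
  rw [integral_Ioi_of_hasDerivAt_of_tendsto' hd hi ht]
  norm_num

lemma ker_int : Integrable (fun y : E2 => 2 / (‖y‖ ^ 2 + 1) ^ 2) := by
  have := (integrable_fun_norm_addHaar (volume : Measure E2)
    (f := fun r : ℝ => 2 / (r ^ 2 + 1) ^ 2)).2
  apply this
  simpa using rad.1

lemma ker_val : ∫ y : E2, 2 / (‖y‖ ^ 2 + 1) ^ 2 = 2 * π := by
  rw [integral_fun_norm_addHaar (volume : Measure E2)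
    (fun r : ℝ => 2 / (r ^ 2 + 1) ^ 2)]
  have := rad.2
  simp [Measure.real, this, Real.pi_pos.le]

lemma step3 (xs : E2) {φ : E2 → ℝ} (hφ : Continuous φ) (hs : HasCompactSupport φ)
    {c : ℕ → ℝ} (hc : Tendsto c atTop (nhds 0)) :
    Tendsto (fun n => ∫ y : E2, 2 / (‖y‖ ^ 2 + 1) ^ 2 * φ (xs + c n • y)) atTop
      (nhds (2 * π * φ xs)) := by
  obtain ⟨M, hM⟩ := hφ.bounded_above_of_compact_support hs
  rw [← ker_val, ← integral_mul_const]
  refine tendsto_integral_of_dominated_convergence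
    (fun y : E2 => 2 / (‖y‖ ^ 2 + 1) ^ 2 * M) ?_ (ker_int.mul_const M) ?_ ?_
  · intro n
    exact ker_int.aestronglyMeasurable.mul (by fun_prop : Continuous fun y : E2 =>
      φ (xs + c n • y)).aestronglyMeasurable
  · intro n
    refine ae_of_all _ fun y => ?_
    rw [norm_mul, Real.norm_of_nonneg (by positivity)]
    gcongr
    exact hM _
  · refine ae_of_all _ fun y => ?_
    refine Tendsto.const_mul _ ?_
    have : Tendsto (fun n => xs + c n • y) atTop (nhds (xs + (0 : ℝ) • y)) :=
      tendsto_const_nhds.add (hc.smul_const y)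
    rw [zero_smul, add_zero] at this
    exact (hφ.tendsto xs).comp this

lemma log_locInt : LocallyIntegrable (fun x : E2 => Real.log ‖x‖) := by
  have hb : ∀ r : ℝ, IntegrableOn (fun x : E2 => Real.log ‖x‖) (Metric.ball 0 r) := by
    intro r
    rw [integrableOn_fun_norm_addHaar]
    have := (Real.continuous_mul_log.integrableOn_Icc (a := 0) (b := r)
      (μ := volume)).mono_set Set.Ioo_subset_Icc_self
    simpa using this
  intro x
  exact ⟨Metric.ball 0 (‖x‖ + 1), Metric.isOpen_ball.mem_nhds (by simp), hb _⟩

lemma log_mul_int (xs : E2) {h : E2 → ℝ} (hh : Continuous h) (hs : HasCompactSupport h) :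
    Integrable (fun x => Real.log ‖x - xs‖ * h x) := by
  have h1 : HasCompactSupport (fun y => h (y + xs)) :=
    hs.comp_homeomorph (Homeomorph.addRight xs)
  have h2 := log_locInt.integrable_smul_right_of_hasCompactSupport
    (g := fun y => h (y + xs)) (by fun_prop) h1
  have h3 := h2.comp_sub_right xs
  simpa using h3

lemma GG_bound (xs : E2) {c : ℝ} (hc : 0 < c) (hc1 : c ≤ 1) {x : E2} (hx : x ≠ xs) :
    |GG xs c x| ≤ |Real.log ‖x - xs‖| + GG xs 1 x := by
  have hr : 0 < ‖x - xs‖ := norm_pos_iff.2 (sub_ne_zero.2 hx)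
  have h1 : Real.log ‖x - xs‖ ≤ GG xs c x := by
    have : Real.log (‖x - xs‖ ^ 2) ≤ Real.log (‖x - xs‖ ^ 2 + c ^ 2) :=
      Real.log_le_log (by positivity) (by nlinarith)
    rw [Real.log_pow] at this
    unfold GG
    push_cast at this
    linarith
  have h2 : GG xs c x ≤ GG xs 1 x := by
    unfold GG
    gcongr
  have h3 : 0 ≤ GG xs 1 x := by
    unfold GG
    have := Real.log_nonneg (x := ‖x - xs‖ ^ 2 + 1 ^ 2) (by nlinarith)
    positivity
  have h4 := neg_abs_le (Real.log ‖x - xs‖)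
  rw [abs_le]
  constructor
  · linarith
  · linarith [abs_nonneg (Real.log ‖x - xs‖)]

lemma step4 (xs : E2) {h : E2 → ℝ} (hh : Continuous h) (hs : HasCompactSupport h)
    {c : ℕ → ℝ} (hc : Tendsto c atTop (nhds 0)) (hc0 : ∀ n, 0 < c n) (hc1 : ∀ n, c n ≤ 1) :
    Tendsto (fun n => ∫ x, GG xs (c n) x * h x) atTop
      (nhds (∫ x, Real.log ‖x - xs‖ * h x)) := by
  have hne : ∀ᵐ x : E2, x ≠ xs := by
    have : (volume : Measure E2) {xs} = 0 := measure_singleton xs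
    exact compl_mem_ae_iff.2 this
  refine tendsto_integral_of_dominated_convergence
    (fun x => |Real.log ‖x - xs‖ * h x| + |GG xs 1 x * h x|) ?_ ?_ ?_ ?_
  · intro n
    exact ((GG_contDiff xs (hc0 n)).continuous.mul hh).aestronglyMeasurable
  · exact (log_mul_int xs hh hs).abs.add
      (((GG_contDiff xs one_pos).continuous.mul hh).integrable_of_hasCompactSupport
        hs.mul_left).abs
  · intro n
    filter_upwards [hne] with x hx
    rw [Real.norm_eq_abs, abs_mul, abs_mul, abs_mul, ← add_mul]
    gcongr
    exact (GG_bound xs (hc0 n) (hc1 n) hx).trans (by gcongr; exact le_abs_self _)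
  · filter_upwards [hne] with x hx
    have hr : 0 < ‖x - xs‖ := norm_pos_iff.2 (sub_ne_zero.2 hx)
    refine Tendsto.mul_const _ ?_
    have h1 : Tendsto (fun n => ‖x - xs‖ ^ 2 + c n ^ 2) atTop (nhds (‖x - xs‖ ^ 2 + 0 ^ 2)) :=
      tendsto_const_nhds.add (hc.pow 2)
    have h2 := (h1.log (by positivity)).const_mul (1 / 2)
    have h3 : 1 / 2 * Real.log (‖x - xs‖ ^ 2 + 0 ^ 2) = Real.log ‖x - xs‖ := by
      rw [zero_pow two_ne_zero, add_zero, Real.log_pow]; push_cast; ring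
    rw [h3] at h2
    exact h2

/-- `-(1/(2π)) log ‖· - x*‖` is the Green function of the two-dimensional
Poisson equation: its Laplacian is minus the Dirac delta at x*, in the distributional sense. -/
theorem stmt_7 (xs : EuclideanSpace ℝ (Fin 2))
    (φ : EuclideanSpace ℝ (Fin 2) → ℝ)
    (hφ : ContDiff ℝ (⊤ : ℕ∞) φ) (hsupp : HasCompactSupport φ) :
    Integrable (fun x : EuclideanSpace ℝ (Fin 2) =>
      (-(1 / (2 * Real.pi)) * Real.log ‖x - xs‖) *
        ∑ i : Fin 2, pd i (fun y => pd i φ y) x) ∧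
    ∫ x : EuclideanSpace ℝ (Fin 2),
      (-(1 / (2 * Real.pi)) * Real.log ‖x - xs‖) *
        ∑ i : Fin 2, pd i (fun y => pd i φ y) x
      = -φ xs := by
  have hcont : Continuous (fun x => ∑ i : Fin 2, pd i (pd i φ) x) :=
    continuous_finsetSum _ fun i _ => (pd_contDiff i (pd_contDiff i hφ)).continuous
  have hs : HasCompactSupport (fun x => ∑ i : Fin 2, pd i (pd i φ) x) := by
    simp_rw [Fin.sum_univ_two]
    exact (pd_supp 0 (pd_supp 0 hsupp)).add (pd_supp 1 (pd_supp 1 hsupp))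
  have hint := log_mul_int xs hcont hs
  have heq : (fun x : EuclideanSpace ℝ (Fin 2) =>
      (-(1 / (2 * Real.pi)) * Real.log ‖x - xs‖) *
        ∑ i : Fin 2, pd i (fun y => pd i φ y) x) = fun x => -(1 / (2 * Real.pi)) *
        (Real.log ‖x - xs‖ * ∑ i : Fin 2, pd i (pd i φ) x) := by
    ext x
    rw [mul_assoc]
  rw [heq]
  refine ⟨hint.const_mul _, ?_⟩
  rw [integral_const_mul]
  have hc : Tendsto (fun n : ℕ => 1 / ((n : ℝ) + 1)) atTop (nhds 0) :=
    tendsto_one_div_add_atTop_nhds_zero_nat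
  have hc0 : ∀ n : ℕ, 0 < 1 / ((n : ℝ) + 1) := fun n => by positivity
  have hc1 : ∀ n : ℕ, 1 / ((n : ℝ) + 1) ≤ 1 := fun n => by
    rw [div_le_one (by positivity)]
    have : (0 : ℝ) ≤ n := n.cast_nonneg
    linarith
  have hA := step4 xs hcont hs hc hc0 hc1
  have hB := step3 xs hφ.continuous hsupp hc
  have hAB := fun n : ℕ => (step1 xs (hc0 n) hφ hsupp).trans (step2 xs (hc0 n) φ)
  simp_rw [hAB] at hA
  rw [tendsto_nhds_unique hA hB]
  have := Real.pi_ne_zero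
  field_simp
end

section
/- Let λ ∈ {−1, 1}, t* ∈ ℝ, x* ∈ ℝ, r₂ > 0, and let ψ : ℝ × ℝ → ℝ be twice continuously differentiable, where ∂_t and ∂_x denote the partial derivatives in the first (time) and second (space) variable and □ψ := ∂_x∂_xψ − ∂_t∂_tψ. Define Ψ : ℝ → ℝ by Ψ(x) = (∂_xψ)(t* + λr₂, x) − λ·((x − x*)/r₂)·(∂_tψ)(t* + λr₂, x). Then: ψ(t*, x*) − (1/2)·[ψ(t* + λr₂, x* − r₂) + ψ(t* + λr₂, x* + r₂)] = (1/2)·∫_{x*−r₂}^{x*+r₂} |x − x*|·(□ψ)(t* + λ|x − x*|, x) dx − λ·∫_{x*−r₂}^{x*+r₂} (∂_tψ)(t* + λ|x − x*|, x) dx + (r₂/2)·[Ψ(x* − r₂) − Ψ(x* + r₂)]. -/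
open MeasureTheory Real Filter

noncomputable def pdT1 (ψ : ℝ × ℝ → ℝ) (p : ℝ × ℝ) : ℝ :=
  deriv (fun s => ψ (s, p.2)) p.1

noncomputable def pdX1 (ψ : ℝ × ℝ → ℝ) (p : ℝ × ℝ) : ℝ :=
  deriv (fun y => ψ (p.1, y)) p.2

noncomputable def dAlem1 (ψ : ℝ × ℝ → ℝ) (p : ℝ × ℝ) : ℝ :=
  pdX1 (pdX1 ψ) p - pdT1 (pdT1 ψ) p

lemma pdT1_eq {ψ : ℝ × ℝ → ℝ} (h : Differentiable ℝ ψ) :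
    pdT1 ψ = fun p => fderiv ℝ ψ p (1, 0) := by
  funext p
  have h1 : HasDerivAt (fun s : ℝ => (s, p.2)) ((1 : ℝ), (0 : ℝ)) p.1 :=
    (hasDerivAt_id p.1).prodMk (hasDerivAt_const p.1 p.2)
  have h2 : HasFDerivAt ψ (fderiv ℝ ψ p) (p.1, p.2) := (h p).hasFDerivAt
  exact (h2.comp_hasDerivAt p.1 h1).deriv

lemma pdX1_eq {ψ : ℝ × ℝ → ℝ} (h : Differentiable ℝ ψ) :
    pdX1 ψ = fun p => fderiv ℝ ψ p (0, 1) := by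
  funext p
  have h1 : HasDerivAt (fun s : ℝ => (p.1, s)) ((0 : ℝ), (1 : ℝ)) p.2 :=
    (hasDerivAt_const p.2 p.1).prodMk (hasDerivAt_id p.2)
  have h2 : HasFDerivAt ψ (fderiv ℝ ψ p) (p.1, p.2) := (h p).hasFDerivAt
  exact (h2.comp_hasDerivAt p.2 h1).deriv

lemma ray_deriv {φ : ℝ × ℝ → ℝ} (h : Differentiable ℝ φ) (ts xs m x : ℝ) :
    HasDerivAt (fun x => φ (ts + m * (x - xs), x))
      (m * pdT1 φ (ts + m * (x - xs), x) + pdX1 φ (ts + m * (x - xs), x)) x := by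
  have h1 : HasDerivAt (fun x : ℝ => (ts + m * (x - xs), x)) (m, (1 : ℝ)) x := by
    refine HasDerivAt.prodMk ?_ (hasDerivAt_id x)
    simpa using (((hasDerivAt_id x).sub_const xs).const_mul m).const_add ts
  have h2 := (h (ts + m * (x - xs), x)).hasFDerivAt.comp_hasDerivAt_of_eq x h1 rfl
  refine h2.congr_deriv ?_
  rw [pdT1_eq h, pdX1_eq h]
  have : ((m, 1) : ℝ × ℝ) = m • ((1 : ℝ), (0 : ℝ)) + ((0 : ℝ), (1 : ℝ)) := by ext <;> simp
  simp only [this, map_add, map_smul, smul_eq_mul]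

lemma contDiff_fd {ψ : ℝ × ℝ → ℝ} (h : ContDiff ℝ 2 ψ) (v : ℝ × ℝ) :
    ContDiff ℝ 1 (fun p => fderiv ℝ ψ p v) :=
  (h.fderiv_right (m := 1) (by norm_num)).clm_apply contDiff_const

lemma pd_comm {ψ : ℝ × ℝ → ℝ} (h : ContDiff ℝ 2 ψ) (p : ℝ × ℝ) :
    pdT1 (pdX1 ψ) p = pdX1 (pdT1 ψ) p := by
  have hd : Differentiable ℝ ψ := h.differentiable (by norm_num)
  have hf : Differentiable ℝ (fderiv ℝ ψ) :=
    (h.fderiv_right (m := 1) (by norm_num)).differentiable (by norm_num)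
  have key : ∀ v w : ℝ × ℝ, fderiv ℝ (fun p => fderiv ℝ ψ p v) p w
      = fderiv ℝ (fderiv ℝ ψ) p w v := by
    intro v w
    rw [fderiv_clm_apply (hf p) (differentiableAt_const v)]
    simp
  rw [pdX1_eq hd, pdT1_eq hd,
    pdT1_eq ((contDiff_fd h _).differentiable (by norm_num)),
    pdX1_eq ((contDiff_fd h _).differentiable (by norm_num))]
  simp only [key]
  exact (h.contDiffAt.isSymmSndFDerivAt (by simp)).eq _ _

lemma half_deriv {ψ : ℝ × ℝ → ℝ} (h : ContDiff ℝ 2 ψ) (ts xs m s x : ℝ) (hm : m * m = 1) :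
    HasDerivAt (fun x => s * (x - xs) / 2 * (pdX1 ψ (ts + m * (x - xs), x)
        - m * pdT1 ψ (ts + m * (x - xs), x)) - s / 2 * ψ (ts + m * (x - xs), x))
      (1 / 2 * (s * (x - xs) * dAlem1 ψ (ts + m * (x - xs), x))
        - s * m * pdT1 ψ (ts + m * (x - xs), x)) x := by
  have hd : Differentiable ℝ ψ := h.differentiable (by norm_num)
  have hX : Differentiable ℝ (pdX1 ψ) := by
    rw [pdX1_eq hd]; exact (contDiff_fd h _).differentiable (by norm_num)
  have hT : Differentiable ℝ (pdT1 ψ) := by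
    rw [pdT1_eq hd]; exact (contDiff_fd h _).differentiable (by norm_num)
  have h1 := ray_deriv hd ts xs m x
  have h2 := ray_deriv hX ts xs m x
  have h3 := ray_deriv hT ts xs m x
  have h4 : HasDerivAt (fun x : ℝ => s * (x - xs) / 2) (s / 2) x := by
    simpa using (((hasDerivAt_id x).sub_const xs).const_mul s).div_const 2
  have h5 := (h4.mul (h2.sub (h3.const_mul m))).sub (h1.const_mul (s / 2))
  refine h5.congr_deriv ?_
  simp only [dAlem1, pd_comm h, Pi.sub_apply]
  linear_combination (-s * (x - xs) / 2 * pdT1 (pdT1 ψ) (ts + m * (x - xs), x)) * hm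

/-- the special second integro-differential formula (SIDF) for a biased
functional form in dimension one. -/
theorem stmt_13 (lam : ℝ) (hlam : lam = -1 ∨ lam = 1) (ts xs r₂ : ℝ) (hr : 0 < r₂)
    (ψ : ℝ × ℝ → ℝ) (hψ : ContDiff ℝ 2 ψ) :
    ψ (ts, xs) - (1 / 2) * (ψ (ts + lam * r₂, xs - r₂) + ψ (ts + lam * r₂, xs + r₂))
    = (1 / 2) * (∫ x in (xs - r₂)..(xs + r₂), |x - xs| * dAlem1 ψ (ts + lam * |x - xs|, x))
      - lam * (∫ x in (xs - r₂)..(xs + r₂), pdT1 ψ (ts + lam * |x - xs|, x))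
      + (r₂ / 2) *
          ((pdX1 ψ (ts + lam * r₂, xs - r₂)
              - lam * (((xs - r₂) - xs) / r₂) * pdT1 ψ (ts + lam * r₂, xs - r₂))
           - (pdX1 ψ (ts + lam * r₂, xs + r₂)
              - lam * (((xs + r₂) - xs) / r₂) * pdT1 ψ (ts + lam * r₂, xs + r₂))) := by
  have hd : Differentiable ℝ ψ := hψ.differentiable (by norm_num)
  have hX : ContDiff ℝ 1 (pdX1 ψ) := by rw [pdX1_eq hd]; exact contDiff_fd hψ _
  have hT : ContDiff ℝ 1 (pdT1 ψ) := by rw [pdT1_eq hd]; exact contDiff_fd hψ _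
  have hXX : Continuous (pdX1 (pdX1 ψ)) := by
    rw [pdX1_eq (hX.differentiable (by norm_num))]
    exact (hX.continuous_fderiv (by norm_num)).clm_apply continuous_const
  have hTT : Continuous (pdT1 (pdT1 ψ)) := by
    rw [pdT1_eq (hT.differentiable (by norm_num))]
    exact (hT.continuous_fderiv (by norm_num)).clm_apply continuous_const
  have hB : Continuous (dAlem1 ψ) := hXX.sub hTT
  have hT0 : Continuous (pdT1 ψ) := hT.continuous
  have hl : lam * lam = 1 := by rcases hlam with h | h <;> rw [h] <;> norm_num
  have c1 : Continuous (fun x => |x - xs| * dAlem1 ψ (ts + lam * |x - xs|, x)) := by fun_prop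
  have c2 : Continuous (fun x => pdT1 ψ (ts + lam * |x - xs|, x)) := by fun_prop
  have c3 : Continuous (fun x => 1 / 2 * (|x - xs| * dAlem1 ψ (ts + lam * |x - xs|, x))
      - lam * pdT1 ψ (ts + lam * |x - xs|, x)) := by fun_prop
  have e0 : (1 / 2) * (∫ x in (xs - r₂)..(xs + r₂), |x - xs| * dAlem1 ψ (ts + lam * |x - xs|, x))
      - lam * (∫ x in (xs - r₂)..(xs + r₂), pdT1 ψ (ts + lam * |x - xs|, x))
      = ∫ x in (xs - r₂)..(xs + r₂), (1 / 2 * (|x - xs| * dAlem1 ψ (ts + lam * |x - xs|, x))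
      - lam * pdT1 ψ (ts + lam * |x - xs|, x)) := by
    rw [intervalIntegral.integral_sub ((c1.intervalIntegrable _ _).const_mul _)
      ((c2.intervalIntegrable _ _).const_mul _), intervalIntegral.integral_const_mul,
      intervalIntegral.integral_const_mul]
  have eR := intervalIntegral.integral_eq_sub_of_hasDerivAt (a := xs) (b := xs + r₂)
    (f := fun x => 1 * (x - xs) / 2 * (pdX1 ψ (ts + lam * (x - xs), x)
        - lam * pdT1 ψ (ts + lam * (x - xs), x)) - 1 / 2 * ψ (ts + lam * (x - xs), x))
    (f' := fun x => 1 / 2 * (|x - xs| * dAlem1 ψ (ts + lam * |x - xs|, x))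
      - lam * pdT1 ψ (ts + lam * |x - xs|, x)) (by
      intro x hx
      rw [Set.uIcc_of_le (by linarith)] at hx
      have := half_deriv hψ ts xs lam 1 x hl
      rw [abs_of_nonneg (by linarith [hx.1])]
      simpa only [one_mul] using this) (c3.intervalIntegrable _ _)
  have eL := intervalIntegral.integral_eq_sub_of_hasDerivAt (a := xs - r₂) (b := xs)
    (f := fun x => (-1) * (x - xs) / 2 * (pdX1 ψ (ts + (-lam) * (x - xs), x)
        - (-lam) * pdT1 ψ (ts + (-lam) * (x - xs), x))
        - (-1) / 2 * ψ (ts + (-lam) * (x - xs), x))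
    (f' := fun x => 1 / 2 * (|x - xs| * dAlem1 ψ (ts + lam * |x - xs|, x))
      - lam * pdT1 ψ (ts + lam * |x - xs|, x)) (by
      intro x hx
      rw [Set.uIcc_of_le (by linarith)] at hx
      have := half_deriv hψ ts xs (-lam) (-1) x (by linarith)
      rw [abs_of_nonpos (by linarith [hx.2])]
      have e : lam * -(x - xs) = -lam * (x - xs) := by ring
      rw [e]
      refine this.congr_deriv ?_
      ring) (c3.intervalIntegrable _ _)
  rw [e0, ← intervalIntegral.integral_add_adjacent_intervals
    (c3.intervalIntegrable (xs - r₂) xs) (c3.intervalIntegrable xs (xs + r₂)), eL, eR]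
  have a1 : xs - r₂ - xs = -r₂ := by ring
  have a2 : xs + r₂ - xs = r₂ := by ring
  have a3 : -r₂ / r₂ = -1 := by field_simp
  have a4 : r₂ / r₂ = 1 := by field_simp
  simp only [a1, a2, a3, a4, sub_self, mul_zero, add_zero, neg_mul_neg]
  ring
end
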